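/- Let Γ=(G,𝓛) be a 2-person edge-symmetric terminal game satisfying condition (CIW) and the simplifying conditions (S1), (S2), (S3). Let σ⁰ be a 1-basic situation with all plays finite, and define σʲ (j=1,2,…) by applying a uniform best improvement of player 1 to σ^{j-1} for odd j and of player 2 for even j, as long as such an improvement exists. Then for every j≥1 and every position v∈V one has 𝓛^{i(v)}(σ^{j+1},v) ≤ 𝓛^{i(v)}(σʲ,v); consequently ν(σ^{j+1}) < ν(σʲ) where ν(σ)=Σ_{v∈V∖V_T} 𝓛^{i(v)}(σ,v), and the process terminates after finitely many steps in a uniform Nash equilibrium. -/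

import Mathlib

open scoped Classical

section CoreDefs

variable {V : Type}

/-- A position is terminal iff it has no outgoing edges. -/
def Terminal (E : V → V → Prop) (v : V) : Prop := ∀ u, ¬ E v u

/-- A situation (profile of pure stationary strategies), encoded as a single
successor map: at every non-terminal position it must follow an edge. -/
def IsSituation (E : V → V → Prop) (s : V → V) : Prop :=
  ∀ v, ¬ Terminal E v → E v (s v)

/-- `s'` is a unilateral deviation of player `i` from `s`: they agree at every
position not controlled by `i` (terminals are controlled by nobody). -/
def Deviation {n : ℕ} (E : V → V → Prop) (owner : V → Fin n) (i : Fin n)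
    (s s' : V → V) : Prop :=
  ∀ v, (owner v ≠ i ∨ Terminal E v) → s' v = s v

/-- The play of `s` started at `v` reaches a terminal position. -/
def Reaches (E : V → V → Prop) (s : V → V) (v : V) : Prop :=
  ∃ k, Terminal E (s^[k] v)

/-- First time the play of `s` from `v` is at a terminal position. -/
noncomputable def stopTime (E : V → V → Prop) (s : V → V) (v : V) : ℕ :=
  sInf {k | Terminal E (s^[k] v)}

/-- The terminal position reached by the play of `s` from `v` (junk if none). -/
noncomputable def playEnd (E : V → V → Prop) (s : V → V) (v : V) : V :=
  s^[stopTime E s v] v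

/-- Effective cost in a terminal game: the cost of the terminal reached,
`0` for an infinite play. -/
noncomputable def tCost (E : V → V → Prop) (L : V → ℝ) (s : V → V) (v : V) : ℝ :=
  if Reaches E s v then L (playEnd E s v) else 0

/-- Effective cost in a positive shortest path game: the total length of the
play if it terminates, `+∞` for an infinite play. -/
noncomputable def spCost (E : V → V → Prop) (l : V → V → ℝ) (s : V → V) (v : V) : EReal :=
  if Reaches E s v then
    (((Finset.range (stopTime E s v)).sum fun k => l (s^[k] v) (s^[k+1] v) : ℝ) : EReal)
  else ⊤

/-- Edge-symmetry: every move can be reversed, except moves entering terminals. -/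
def EdgeSymm (E : V → V → Prop) : Prop :=
  ∀ u v, E u v → ¬ Terminal E v → E v u

end CoreDefs
section UniformDefs

variable {V : Type}

/-- `s` is a situation in which player `i`'s strategy is a uniform best
response to the opponents' strategies: no unilateral deviation of `i`
improves `i`'s cost from any initial position. -/
def UBR {n : ℕ} (E : V → V → Prop) (owner : V → Fin n) (L : Fin n → V → ℝ)
    (i : Fin n) (s : V → V) : Prop :=
  ∀ s', IsSituation E s' → Deviation E owner i s s' →
    ∀ v, tCost E (L i) s v ≤ tCost E (L i) s' v

/-- `s'` is obtained from `s` by a uniform best improvement of player `i`. -/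
def UBI {n : ℕ} (E : V → V → Prop) (owner : V → Fin n) (L : Fin n → V → ℝ)
    (i : Fin n) (s s' : V → V) : Prop :=
  IsSituation E s' ∧ Deviation E owner i s s' ∧ s' ≠ s ∧
  UBR E owner L i s' ∧
  ∀ v, owner v = i → ¬ Terminal E v →
    s' v = s v ∨ tCost E (L i) s' v < tCost E (L i) s v

/-- `s` is `i`-basic: every position `v` with a terminal out-neighbour `w`
either uses the terminal move, or every uniform best improvement of player `i`
gives the owner of `v` a strictly better value at `v` than that terminal. -/
def IBasic {n : ℕ} (E : V → V → Prop) (owner : V → Fin n) (L : Fin n → V → ℝ)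
    (i : Fin n) (s : V → V) : Prop :=
  ∀ v w, E v w → Terminal E w →
    s v = w ∨ ∀ s', UBI E owner L i s s' → tCost E (L (owner v)) s' v < L (owner v) w

/-- (S1): every edge between two distinct non-terminal vertices joins positions
of different players. -/
def CondS1 {n : ℕ} (E : V → V → Prop) (owner : V → Fin n) : Prop :=
  ∀ u v, E u v → u ≠ v → ¬ Terminal E u → ¬ Terminal E v → owner u ≠ owner v

/-- (S2): every position has at most one terminal out-neighbour. -/
def CondS2 (E : V → V → Prop) : Prop :=
  ∀ v w w', E v w → E v w' → Terminal E w → Terminal E w' → w = w'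

/-- (S3): a terminal position is reachable from every position. -/
def CondS3 (E : V → V → Prop) : Prop :=
  ∀ v : V, ∃ w, Terminal E w ∧ Relation.ReflTransGen E v w

/-- Uniform Nash equilibrium: a situation that is a Nash equilibrium for every
choice of the initial position. -/
def IsUNE {n : ℕ} (E : V → V → Prop) (owner : V → Fin n) (L : Fin n → V → ℝ)
    (s : V → V) : Prop :=
  IsSituation E s ∧ ∀ i s', IsSituation E s' → Deviation E owner i s s' →
    ∀ v, tCost E (L i) s v ≤ tCost E (L i) s' v

end UniformDefs

/-- The measure of progress `ν(σ) = Σ_{v ∈ V ∖ V_T} 𝓛^{i(v)}(σ, v)`. -/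
noncomputable def nuVal {V : Type} [Fintype V] {n : ℕ} (E : V → V → Prop)
    (owner : V → Fin n) (L : Fin n → V → ℝ) (s : V → V) : ℝ :=
  (Finset.univ.filter fun v => ¬ Terminal E v).sum fun v =>
    tCost E (L (owner v)) s v

/-- The player due to move at step `j`: player 1 (`0 : Fin 2`) for odd `j`,
player 2 (`1 : Fin 2`) for even `j`. -/
def duePlayer (j : ℕ) : Fin 2 := if j % 2 = 1 then 0 else 1

section PlayLemmas

variable {V : Type} {E : V → V → Prop} {s : V → V} {v : V}

lemma Reaches.of_terminal (hv : Terminal E v) : Reaches E s v := ⟨0, hv⟩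

lemma reaches_succ_iff (hv : ¬ Terminal E v) : Reaches E s (s v) ↔ Reaches E s v := by
  constructor
  · rintro ⟨k, hk⟩
    exact ⟨k + 1, hk⟩
  · rintro ⟨k, hk⟩
    cases k with
    | zero => exact absurd hk hv
    | succ k => exact ⟨k, hk⟩

/-- Induction along a terminating play, from its end backwards. -/
@[elab_as_elim]
lemma Reaches.backward_induction {P : V → Prop} (hterm : ∀ v, Terminal E v → P v)
    (hsucc : ∀ v, ¬ Terminal E v → Reaches E s v → P (s v) → P v) (h : Reaches E s v) :
    P v := by
  obtain ⟨k, hk⟩ := h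
  induction k generalizing v with
  | zero => exact hterm v hk
  | succ k ih =>
    by_cases hv : Terminal E v
    · exact hterm v hv
    · exact hsucc v hv ⟨k + 1, hk⟩ (ih hk)

lemma tCost_of_terminal (L : V → ℝ) (hv : Terminal E v) : tCost E L s v = L v := by
  have h0 : stopTime E s v = 0 := Nat.sInf_eq_zero.2 (Or.inl hv)
  simp [tCost, Reaches.of_terminal hv, playEnd, h0]

lemma stopTime_eq_succ (hv : ¬ Terminal E v) (h : Reaches E s v) :
    stopTime E s v = stopTime E s (s v) + 1 := by
  have hmem : 0 ∉ {k | Terminal E (s^[k] v)} := hv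
  have hpos : 0 < stopTime E s v :=
    Nat.pos_of_ne_zero fun h0 => hmem (h0 ▸ Nat.sInf_mem (s := {k | Terminal E (s^[k] v)}) h)
  exact (Nat.sInf_add (n := 1) (p := fun k => Terminal E (s^[k] v)) hpos).symm

lemma tCost_succ (L : V → ℝ) (hv : ¬ Terminal E v) :
    tCost E L s (s v) = tCost E L s v := by
  by_cases h : Reaches E s v
  · simp [tCost, h, (reaches_succ_iff hv).2 h, playEnd, stopTime_eq_succ hv h]
  · simp [tCost, h, mt (reaches_succ_iff hv).1 h]

lemma tCost_neg {L : V → ℝ} (hL : ∀ w, Terminal E w → L w < 0) (h : Reaches E s v) :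
    tCost E L s v < 0 := by
  refine h.backward_induction (fun v hv => ?_) fun v hv _ ih => ?_
  · rw [tCost_of_terminal L hv]; exact hL v hv
  · rwa [← tCost_succ L hv]

lemma reaches_of_tCost_neg {L : V → ℝ} (h : tCost E L s v < 0) : Reaches E s v := by
  by_contra hr
  simp [tCost, hr] at h

/-- A potential that does not increase along the play bounds its cost from above. -/
lemma tCost_le_of_antitone {L f : V → ℝ} (hterm : ∀ w, Terminal E w → f w = L w)
    (hstep : ∀ u, ¬ Terminal E u → f (s u) ≤ f u) (h : Reaches E s v) :
    tCost E L s v ≤ f v := by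
  refine h.backward_induction (fun v hv => ?_) fun v hv _ ih => ?_
  · rw [tCost_of_terminal L hv, hterm v hv]
  · rw [← tCost_succ L hv]; exact ih.trans (hstep v hv)

/-- A potential that does not decrease along the play bounds its cost from below. -/
lemma le_tCost_of_monotone {L f : V → ℝ} (hterm : ∀ w, Terminal E w → f w = L w)
    (hstep : ∀ u, ¬ Terminal E u → f u ≤ f (s u)) (h : Reaches E s v) :
    f v ≤ tCost E L s v := by
  refine h.backward_induction (fun v hv => ?_) fun v hv _ ih => ?_
  · rw [tCost_of_terminal L hv, hterm v hv]
  · rw [← tCost_succ L hv]; exact (hstep v hv).trans ih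

/-- Redirecting a position to a successor of different cost keeps the successor's play. -/
lemma reaches_and_tCost_update_of_ne {L : V → ℝ} {w u x : V} (hx : Reaches E s x)
    (hne : tCost E L s x ≠ tCost E L s w) :
    Reaches E (Function.update s w u) x ∧
      tCost E L (Function.update s w u) x = tCost E L s x := by
  revert hne
  refine hx.backward_induction (fun v hv _ => ?_) fun v hv _ ih hne => ?_
  · exact ⟨.of_terminal hv, by simp only [tCost_of_terminal L hv]⟩
  · have hvw : v ≠ w := by rintro rfl; exact hne rfl
    have hs : Function.update s w u v = s v := Function.update_of_ne hvw _ _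
    have ih' := ih (by rwa [tCost_succ L hv])
    rw [← hs, reaches_succ_iff hv, tCost_succ L hv, hs, tCost_succ L hv] at ih'
    exact ih'

lemma tCost_update_self {L : V → ℝ} {w u : V} (hw : ¬ Terminal E w) (hu : Reaches E s u)
    (hne : tCost E L s u ≠ tCost E L s w) :
    tCost E L (Function.update s w u) w = tCost E L s u := by
  rw [← tCost_succ L hw, Function.update_self]
  exact (reaches_and_tCost_update_of_ne hu hne).2

/-- Redirecting a position to a cheaper successor does not increase any cost. -/
lemma reaches_and_tCost_update_le {L : V → ℝ} {w u x : V} (hw : ¬ Terminal E w)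
    (hu : Reaches E s u) (hlt : tCost E L s u < tCost E L s w) (hx : Reaches E s x) :
    Reaches E (Function.update s w u) x ∧
      tCost E L (Function.update s w u) x ≤ tCost E L s x := by
  refine hx.backward_induction (fun v hv => ?_) fun v hv _ ih => ?_
  · exact ⟨.of_terminal hv, by simp only [tCost_of_terminal L hv, le_refl]⟩
  · by_cases hvw : v = w
    · subst hvw
      refine ⟨?_, (tCost_update_self hv hu hlt.ne).trans_le hlt.le⟩
      rw [← reaches_succ_iff hv, Function.update_self]
      exact (reaches_and_tCost_update_of_ne hu hlt.ne).1
    · have hs : Function.update s w u v = s v := Function.update_of_ne hvw _ _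
      rw [← hs, reaches_succ_iff hv, tCost_succ L hv, hs, tCost_succ L hv] at ih
      exact ih

end PlayLemmas

section ImprovementLemmas

variable {V : Type} {n : ℕ} {E : V → V → Prop} {owner : V → Fin n} {L : Fin n → V → ℝ}
  {i : Fin n} {s s' : V → V}

lemma IsSituation.update {w u : V} (hs : IsSituation E s) (hwu : E w u) :
    IsSituation E (Function.update s w u) := by
  intro v hv
  by_cases h : v = w
  · subst h; rwa [Function.update_self]
  · rw [Function.update_of_ne h]; exact hs v hv

lemma Deviation.symm (h : Deviation E owner i s s') : Deviation E owner i s' s :=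
  fun v hv => (h v hv).symm

lemma Deviation.update {w u : V} (h : Deviation E owner i s s') (how : owner w = i)
    (hw : ¬ Terminal E w) : Deviation E owner i s (Function.update s' w u) := by
  intro v hv
  have hvw : v ≠ w := by
    rintro rfl
    exact hv.elim (· how) hw
  rw [Function.update_of_ne hvw]
  exact h v hv

lemma UBR.tCost_le_of_edge {w u : V} (h : UBR E owner L i s) (hs : IsSituation E s)
    (hfin : ∀ v, Reaches E s v) (how : owner w = i) (hwu : E w u) :
    tCost E (L i) s w ≤ tCost E (L i) s u := by
  by_contra! hlt
  have hw : ¬ Terminal E w := fun ht => ht u hwu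
  have hle := h _ (hs.update hwu) (Deviation.update (fun _ _ => rfl) how hw) w
  rw [tCost_update_self hw (hfin u) hlt.ne] at hle
  exact hle.not_gt hlt

lemma UBR.of_forall_edge (hL : ∀ w, Terminal E w → L i w < 0) (hfin : ∀ v, Reaches E s v)
    (h : ∀ w u, owner w = i → E w u → tCost E (L i) s w ≤ tCost E (L i) s u) :
    UBR E owner L i s := by
  intro s' hs' hdev v
  by_cases hr : Reaches E s' v
  · refine le_tCost_of_monotone (fun w hw => tCost_of_terminal _ hw) (fun u hu => ?_) hr
    by_cases hou : owner u = i
    · exact h u _ hou (hs' u hu)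
    · rw [hdev u (.inl hou), tCost_succ _ hu]
  · have h0 : tCost E (L i) s' v = 0 := if_neg hr
    rw [h0]
    exact (tCost_neg hL (hfin v)).le

lemma UBI.tCost_le (h : UBI E owner L i s s') (hs : IsSituation E s) (v : V) :
    tCost E (L i) s' v ≤ tCost E (L i) s v :=
  h.2.2.2.1 s hs h.2.1.symm v

lemma UBI.reaches (h : UBI E owner L i s s') (hL : ∀ w, Terminal E w → L i w < 0)
    (hs : IsSituation E s) (hfin : ∀ v, Reaches E s v) (v : V) : Reaches E s' v :=
  reaches_of_tCost_neg ((h.tCost_le hs v).trans_lt (tCost_neg hL (hfin v)))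

lemma UBI.of_apply_ne {v : V} (h : UBI E owner L i s s') (hv : s' v ≠ s v) :
    owner v = i ∧ ¬ Terminal E v ∧ tCost E (L i) s' v < tCost E (L i) s v := by
  have how : owner v = i := by
    by_contra ho
    exact hv (h.2.1 v (.inl ho))
  have ht : ¬ Terminal E v := fun ht => hv (h.2.1 v (.inr ht))
  exact ⟨how, ht, (h.2.2.2.2 v how ht).resolve_left hv⟩

lemma UBI.nuVal_lt [Fintype V] (h : UBI E owner L i s s')
    (hle : ∀ v, tCost E (L (owner v)) s' v ≤ tCost E (L (owner v)) s v) :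
    nuVal E owner L s' < nuVal E owner L s := by
  obtain ⟨v, hv⟩ := Function.ne_iff.1 h.2.2.1
  obtain ⟨how, ht, hlt⟩ := h.of_apply_ne hv
  refine Finset.sum_lt_sum (fun v _ => hle v) ⟨v, by simp [ht], ?_⟩
  rwa [how]

/-- From a situation with finite plays, a player whose strategy is not a uniform best
response has a uniform best improvement. -/
lemma exists_UBI_of_not_UBR [Fintype V] (hL : ∀ w, Terminal E w → L i w < 0)
    (hs : IsSituation E s) (hfin : ∀ v, Reaches E s v) (hnot : ¬ UBR E owner L i s) :
    ∃ s', UBI E owner L i s s' := by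
  let C : Set (V → V) := {r | IsSituation E r ∧ Deviation E owner i s r ∧
    (∀ v, Reaches E r v) ∧ (∀ v, tCost E (L i) r v ≤ tCost E (L i) s v) ∧
    ∀ v, r v = s v ∨ tCost E (L i) r v < tCost E (L i) s v}
  obtain ⟨r, hrC, hmin⟩ := (Set.toFinite C).exists_minimalFor
    (fun r => ∑ v, tCost E (L i) r v) C
    ⟨s, hs, fun _ _ => rfl, hfin, fun _ => le_rfl, fun _ => .inl rfl⟩
  obtain ⟨hr, hdev, hrfin, hle, himp⟩ := hrC
  have hbest : UBR E owner L i r := by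
    refine UBR.of_forall_edge hL hrfin fun w u how hwu => ?_
    by_contra! hlt
    have hw : ¬ Terminal E w := fun ht => ht u hwu
    have hself := tCost_update_self hw (hrfin u) hlt.ne
    have hupd := fun x => reaches_and_tCost_update_le hw (hrfin u) hlt (hrfin x)
    have hmem : Function.update r w u ∈ C := by
      refine ⟨hr.update hwu, hdev.update how hw, fun x => (hupd x).1,
        fun x => (hupd x).2.trans (hle x), fun x => ?_⟩
      by_cases hx : x = w
      · subst hx
        exact .inr (hself.trans_lt (hlt.trans_le (hle x)))
      · rw [Function.update_of_ne hx]
        exact (himp x).imp_right (hupd x).2.trans_lt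
    have hsum : ∑ v, tCost E (L i) (Function.update r w u) v < ∑ v, tCost E (L i) r v :=
      Finset.sum_lt_sum (fun x _ => (hupd x).2) ⟨w, Finset.mem_univ w, hself.trans_lt hlt⟩
    exact (hmin hmem hsum.le).not_gt hsum
  exact ⟨r, hr, hdev, fun h => hnot (h ▸ hbest), hbest, fun v _ _ => himp v⟩

end ImprovementLemmas

section TwoPlayers

variable {V : Type} {E : V → V → Prop} {owner : V → Fin 2} {L : Fin 2 → V → ℝ}

/-- No position costs its owner more than the terminals to which it can move. -/
def TerminalBounded (E : V → V → Prop) (owner : V → Fin 2) (L : Fin 2 → V → ℝ)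
    (s : V → V) : Prop :=
  ∀ v w, E v w → Terminal E w → tCost E (L (owner v)) s v ≤ L (owner v) w

lemma IBasic.terminalBounded {i : Fin 2} {s s' : V → V} (hb : IBasic E owner L i s)
    (h : UBI E owner L i s s') : TerminalBounded E owner L s' := by
  intro v w hvw hw
  have hv : ¬ Terminal E v := fun ht => ht w hvw
  rcases hb v w hvw hw with hsv | hlt
  · have hcost : ∀ r : V → V, r v = w → tCost E (L (owner v)) r v = L (owner v) w := by
      intro r hrv
      rw [← tCost_succ _ hv, hrv, tCost_of_terminal _ hw]
    by_cases hch : s' v = s v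
    · exact (hcost s' (hch.trans hsv)).le
    · obtain ⟨how, -, hlt⟩ := h.of_apply_ne hch
      rw [← hcost s hsv, how]
      exact hlt.le
  · exact (hlt s' h).le

/-- If the opponent's strategy is a uniform best response and no position prefers a terminal
move, then a uniform best improvement hurts the owner of no position. -/
lemma UBI.tCost_owner_le {i p : Fin 2} {s s' : V → V} (hsym : EdgeSymm E)
    (hL : ∀ i w, Terminal E w → L i w < 0) (hS1 : CondS1 E owner) (hip : p ≠ i)
    (hs : IsSituation E s) (hfin : ∀ v, Reaches E s v) (hbr : UBR E owner L p s)
    (hbd : TerminalBounded E owner L s) (h : UBI E owner L i s s') (v : V) :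
    tCost E (L (owner v)) s' v ≤ tCost E (L (owner v)) s v := by
  by_cases hov : owner v = i
  · rw [hov]; exact h.tCost_le hs v
  have hovp : owner v = p := by lia
  have hfin' := h.reaches (hL i) hs hfin
  rw [hovp]
  refine tCost_le_of_antitone (fun w hw => tCost_of_terminal _ hw) (fun u hu => ?_) (hfin' v)
  by_cases hch : s' u = s u
  · rw [hch, tCost_succ _ hu]
  obtain ⟨hou, -, hlt⟩ := h.of_apply_ne hch
  have hedge : E u (s' u) := h.1 u hu
  by_cases hw : Terminal E (s' u)
  · have hle := hbd u _ hedge hw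
    rw [← tCost_succ (s := s') _ hu, tCost_of_terminal _ hw] at hlt
    rw [hou] at hle
    exact absurd hlt hle.not_gt
  by_cases huw : u = s' u
  · rw [← huw]
  have how : owner (s' u) = p := by
    have := hS1 u _ hedge huw hu hw
    lia
  exact hbr.tCost_le_of_edge hs hfin how (hsym u _ hedge hw)

lemma duePlayer_ne_succ (j : ℕ) : duePlayer j ≠ duePlayer (j + 1) := by
  unfold duePlayer
  split_ifs <;> lia

lemma alternating_invariants {σ : ℕ → V → V} {N : ℕ} (hL : ∀ i w, Terminal E w → L i w < 0)
    (h0 : IsSituation E (σ 0)) (hfin : ∀ v, Reaches E (σ 0) v)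
    (hstep : ∀ j, 1 ≤ j → j ≤ N → UBI E owner L (duePlayer j) (σ (j - 1)) (σ j))
    {j : ℕ} (hj : j ≤ N) : IsSituation E (σ j) ∧ ∀ v, Reaches E (σ j) v := by
  induction j with
  | zero => exact ⟨h0, hfin⟩
  | succ j ih =>
    obtain ⟨hs, hf⟩ := ih (by lia)
    have h := hstep (j + 1) (by lia) hj
    exact ⟨h.1, h.reaches (hL _) hs hf⟩

lemma alternating_tCost_le {σ : ℕ → V → V} {N : ℕ} (hsym : EdgeSymm E)
    (hL : ∀ i w, Terminal E w → L i w < 0) (hS1 : CondS1 E owner)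
    (h0 : IsSituation E (σ 0)) (hbasic : IBasic E owner L 0 (σ 0))
    (hfin : ∀ v, Reaches E (σ 0) v)
    (hstep : ∀ j, 1 ≤ j → j ≤ N → UBI E owner L (duePlayer j) (σ (j - 1)) (σ j))
    {j : ℕ} (h1 : 1 ≤ j) (hj : j + 1 ≤ N) (v : V) :
    tCost E (L (owner v)) (σ (j + 1)) v ≤ tCost E (L (owner v)) (σ j) v := by
  have key : ∀ j, 1 ≤ j → j + 1 ≤ N → TerminalBounded E owner L (σ j) → ∀ v,
      tCost E (L (owner v)) (σ (j + 1)) v ≤ tCost E (L (owner v)) (σ j) v := by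
    intro j h1 hj hbd v
    obtain ⟨hs, hf⟩ := alternating_invariants hL h0 hfin hstep (j := j) (by lia)
    exact (hstep (j + 1) (by lia) hj).tCost_owner_le hsym hL hS1 (duePlayer_ne_succ j) hs hf
      (hstep j h1 (by lia)).2.2.2.1 hbd v
  have bounded : ∀ j, 1 ≤ j → j ≤ N → TerminalBounded E owner L (σ j) := by
    intro j h1
    induction j, h1 using Nat.le_induction with
    | base => exact fun hj => hbasic.terminalBounded (hstep 1 le_rfl hj)
    | succ j h1 ih =>
      intro hj v w hvw hw
      exact (key j h1 hj (ih (by lia)) v).trans (ih (by lia) v w hvw hw)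
  exact key j h1 hj (bounded j h1 (by lia)) v

lemma alternating_nuVal_lt [Fintype V] {σ : ℕ → V → V} {N : ℕ} (hsym : EdgeSymm E)
    (hL : ∀ i w, Terminal E w → L i w < 0) (hS1 : CondS1 E owner)
    (h0 : IsSituation E (σ 0)) (hbasic : IBasic E owner L 0 (σ 0))
    (hfin : ∀ v, Reaches E (σ 0) v)
    (hstep : ∀ j, 1 ≤ j → j ≤ N → UBI E owner L (duePlayer j) (σ (j - 1)) (σ j))
    {j : ℕ} (h1 : 1 ≤ j) (hj : j + 1 ≤ N) :
    nuVal E owner L (σ (j + 1)) < nuVal E owner L (σ j) :=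
  (hstep (j + 1) (by lia) hj).nuVal_lt
    (alternating_tCost_le hsym hL hS1 h0 hbasic hfin hstep h1 hj)

lemma alternating_length_le [Fintype V] {σ : ℕ → V → V} {N : ℕ} (hsym : EdgeSymm E)
    (hL : ∀ i w, Terminal E w → L i w < 0) (hS1 : CondS1 E owner)
    (h0 : IsSituation E (σ 0)) (hbasic : IBasic E owner L 0 (σ 0))
    (hfin : ∀ v, Reaches E (σ 0) v)
    (hstep : ∀ j, 1 ≤ j → j ≤ N → UBI E owner L (duePlayer j) (σ (j - 1)) (σ j)) :
    N ≤ Fintype.card (V → V) := by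
  have hanti : StrictAntiOn (fun j => nuVal E owner L (σ j)) (Set.Icc 1 N) :=
    strictAntiOn_of_add_one_lt Set.ordConnected_Icc fun j _ hj hj' =>
      alternating_nuVal_lt hsym hL hS1 h0 hbasic hfin hstep hj.1 hj'.2
  have hinj : Set.InjOn σ (Finset.Icc 1 N) := by
    intro a ha b hb hab
    rw [Finset.coe_Icc] at ha hb
    exact hanti.injOn ha hb (by simp only [hab])
  simpa using Finset.card_le_card_of_injOn (t := Finset.univ) σ (fun _ _ => by simp) hinj

end TwoPlayers

/-- In a 2-person edge-symmetric terminal game satisfying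
(CIW), (S1), (S2), (S3), start from a `1`-basic situation `σ⁰` with all plays
finite, and let players alternate uniform best improvements (player 1 at odd
steps, player 2 at even steps), producing `σ¹, σ², …` as long as possible.
Then for every `j ≥ 1` and every position `v`,
`𝓛^{i(v)}(σ^{j+1}, v) ≤ 𝓛^{i(v)}(σʲ, v)`; consequently `ν(σ^{j+1}) < ν(σʲ)`;
the process terminates after finitely many steps (there is a uniform bound on
the length of every such improvement sequence); and when it terminates — that
is, when no player has a uniform best improvement — the final situation is a
uniform Nash equilibrium. -/
theorem alternating_improvements_terminate_in_UNE
    {V : Type} [Fintype V]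
    (E : V → V → Prop) (owner : V → Fin 2) (L : Fin 2 → V → ℝ)
    (hT : ∃ v, Terminal E v)        -- the set of terminals is nonempty
    (hsym : EdgeSymm E)             -- the game is edge-symmetric
    (hCIW : ∀ i w, Terminal E w → L i w < 0)  -- (CIW)
    (hS1 : CondS1 E owner) (hS2 : CondS2 E) (hS3 : CondS3 E)
    (σ : ℕ → (V → V)) (N : ℕ)
    (h0 : IsSituation E (σ 0))
    (hbasic : IBasic E owner L 0 (σ 0))       -- `σ⁰` is 1-basic
    (hfin : ∀ v, Reaches E (σ 0) v)           -- all plays of `σ⁰` are finite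
    (hstep : ∀ j, 1 ≤ j → j ≤ N →
      UBI E owner L (duePlayer j) (σ (j - 1)) (σ j))  -- alternating improvements
    :
    (∀ j, 1 ≤ j → j + 1 ≤ N → ∀ v : V,
      tCost E (L (owner v)) (σ (j + 1)) v ≤ tCost E (L (owner v)) (σ j) v) ∧
    (∀ j, 1 ≤ j → j + 1 ≤ N →
      nuVal E owner L (σ (j + 1)) < nuVal E owner L (σ j)) ∧
    (∃ M : ℕ, ∀ (τ : ℕ → (V → V)) (N' : ℕ), τ 0 = σ 0 →
      (∀ j, 1 ≤ j → j ≤ N' → UBI E owner L (duePlayer j) (τ (j - 1)) (τ j)) →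
      N' ≤ M) ∧
    ((∀ i s', ¬ UBI E owner L i (σ N) s') → ∀ i, UBR E owner L i (σ N)) := by
  refine ⟨fun j h1 hj => alternating_tCost_le hsym hCIW hS1 h0 hbasic hfin hstep h1 hj,
    fun j h1 hj => alternating_nuVal_lt hsym hCIW hS1 h0 hbasic hfin hstep h1 hj,
    ⟨Fintype.card (V → V), fun τ N' hτ hτstep => ?_⟩, fun hno i => ?_⟩
  · rw [← hτ] at h0 hbasic hfin
    exact alternating_length_le hsym hCIW hS1 h0 hbasic hfin hτstep
  · by_contra hnot
    obtain ⟨hs, hf⟩ := alternating_invariants hCIW h0 hfin hstep le_rfl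
    obtain ⟨s', hs'⟩ := exists_UBI_of_not_UBR (hCIW i) hs hf hnot
    exact hno i s' hs'
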